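/- Let N ≥ 3 and let B be the open unit ball in ℝ^N. Set λ_* = 2(N−1)/(N−2). Then for every λ ∈ [0, λ_*] there is no radial function u, continuously differentiable on the closed unit ball and twice continuously differentiable on B, with u > 0 in B and u = 0 on the unit sphere, satisfying −Δu(x) = (1 + λ·|x|^(N−2))·u(x)^((N+2)/(N−2)) for all x ∈ B. -/

import Mathlib

open scoped NNReal
open MeasureTheory Filter Set Metric

noncomputable def laplacian {N : ℕ} (u : EuclideanSpace ℝ (Fin N) → ℝ)
    (x : EuclideanSpace ℝ (Fin N)) : ℝ :=
  ∑ i, fderiv ℝ (fun y => fderiv ℝ u y (EuclideanSpace.single i (1:ℝ))) x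
      (EuclideanSpace.single i (1:ℝ))

theorem radial_laplacian {N : ℕ} (u : EuclideanSpace ℝ (Fin N) → ℝ) (g g1 : ℝ → ℝ)
    (hu : ∀ y, u y = g ‖y‖) (hg : ∀ t ∈ Ioo (0:ℝ) 1, HasDerivAt g (g1 t) t) (g2 r : ℝ)
    (hr : r ∈ Ioo (0:ℝ) 1) (hg2 : HasDerivAt g1 g2 r)
    (x : EuclideanSpace ℝ (Fin N)) (hx : ‖x‖ = r) :
    laplacian u x = g2 + ((N:ℝ) - 1) / r * g1 r := by
  have hr0 : r ≠ 0 := hr.1.ne'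
  have hnorm : ∀ y : EuclideanSpace ℝ (Fin N), y ≠ 0 →
      HasFDerivAt (fun z : EuclideanSpace ℝ (Fin N) => ‖z‖) ((1 / ‖y‖) • innerSL ℝ y) y := by
    intro y hy
    have h1 := (hasStrictFDerivAt_norm_sq y).hasFDerivAt
    have h2 := h1.sqrt (by simpa using hy)
    have h3 : (fun z : EuclideanSpace ℝ (Fin N) => ‖z‖) = fun z => √(‖z‖ ^ 2) := by
      ext z; rw [Real.sqrt_sq (norm_nonneg _)]
    rw [h3]
    refine h2.congr_fderiv ?_
    rw [Real.sqrt_sq (norm_nonneg _)]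
    ext v
    have : ‖y‖ ≠ 0 := by simpa using hy
    simp
    field_simp
  have hne : ∀ y : EuclideanSpace ℝ (Fin N), ‖y‖ ∈ Ioo (0:ℝ) 1 → y ≠ 0 := by
    intro y hy h
    simp [h] at hy
  have hD : ∀ y : EuclideanSpace ℝ (Fin N), ‖y‖ ∈ Ioo (0:ℝ) 1 → ∀ i,
      fderiv ℝ u y (EuclideanSpace.single i (1:ℝ)) = (g1 ‖y‖ / ‖y‖) * y i := by
    intro y hy i
    have h1 : HasFDerivAt u (g1 ‖y‖ • ((1 / ‖y‖) • innerSL ℝ y)) y := by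
      have := (hg _ hy).comp_hasFDerivAt y (hnorm y (hne y hy))
      exact this.congr_of_eventuallyEq (Eventually.of_forall hu)
    rw [h1.fderiv]
    simp [EuclideanSpace.inner_single_right]
    ring
  have hev : ∀ᶠ y in nhds x, ‖y‖ ∈ Ioo (0:ℝ) 1 := by
    have : Tendsto (fun y : EuclideanSpace ℝ (Fin N) => ‖y‖) (nhds x) (nhds ‖x‖) :=
      continuous_norm.continuousAt
    exact this.eventually (isOpen_Ioo.mem_nhds (by rw [hx]; exact hr))
  have hphi : HasDerivAt (fun t => g1 t / t) ((g2 * r - g1 r * 1) / r ^ 2) r :=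
    hg2.fun_div (hasDerivAt_id r) hr0
  have key : ∀ i, fderiv ℝ (fun y => fderiv ℝ u y (EuclideanSpace.single i (1:ℝ))) x
      (EuclideanSpace.single i (1:ℝ))
      = g1 r / r + ((g2 * r - g1 r * 1) / r ^ 2) / r * (x i) ^ 2 := by
    intro i
    have e : (fun y => fderiv ℝ u y (EuclideanSpace.single i (1:ℝ)))
        =ᶠ[nhds x] fun y => (g1 ‖y‖ / ‖y‖) * y i := by
      filter_upwards [hev] with y hy using hD y hy i
    rw [e.fderiv_eq]
    have h1 : HasFDerivAt (fun y : EuclideanSpace ℝ (Fin N) => g1 ‖y‖ / ‖y‖)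
        (((g2 * r - g1 r * 1) / r ^ 2) • ((1 / ‖x‖) • innerSL ℝ x)) x := by
      have h := hphi
      rw [← hx] at h
      have := h.comp_hasFDerivAt x (hnorm x (hne x (by rw [hx]; exact hr)))
      rw [← hx]
      exact this
    have h2 : HasFDerivAt (fun y : EuclideanSpace ℝ (Fin N) => y i)
        (EuclideanSpace.proj i : EuclideanSpace ℝ (Fin N) →L[ℝ] ℝ) x :=
      (EuclideanSpace.proj i : EuclideanSpace ℝ (Fin N) →L[ℝ] ℝ).hasFDerivAt
    rw [(h1.fun_mul h2).fderiv]
    simp [EuclideanSpace.inner_single_right, hx]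
    ring
  unfold laplacian
  rw [Finset.sum_congr rfl (fun i _ => key i), Finset.sum_add_distrib, ← Finset.mul_sum]
  have hs : ∑ i, (x i) ^ 2 = r ^ 2 := by
    rw [← hx, EuclideanSpace.norm_sq_eq]; simp
  rw [hs]
  simp
  field_simp
  ring

theorem ode_nonexist (m : ℕ) (lam : ℝ) (h0 : 0 ≤ lam) (h1 : lam * (m + 1) ≤ 2 * (m + 2))
    (g w w2 : ℝ → ℝ) (hgc : ContinuousOn g (Icc 0 1)) (hwc : ContinuousOn w (Icc 0 1))
    (hg : ∀ t ∈ Ioo (0:ℝ) 1, HasDerivAt g (w t) t)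
    (hw : ∀ t ∈ Ioo (0:ℝ) 1, HasDerivAt w (w2 t) t)
    (hpos : ∀ t ∈ Ioo (0:ℝ) 1, 0 < g t) (hg1 : g 1 = 0)
    (hode : ∀ t ∈ Ioo (0:ℝ) 1, -(w2 t + ((m:ℝ) + 2) / t * w t)
      = (1 + lam * t ^ (m + 1)) * g t ^ (((m:ℝ) + 5) / (m + 1))) : False := by
  have hn : (0:ℝ) < m + 1 := by positivity
  have hq : (0:ℝ) < (2 * m + 6) / (m + 1) := by positivity
  let P : ℝ → ℝ := fun r => ((m:ℝ) + 1) / 2 * r ^ (m + 2) * (g r * w r) +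
    r ^ (m + 3) * (1 - r ^ (m + 1)) * (w r ^ 2 / 2 +
      (1 + lam * r ^ (m + 1)) * g r ^ ((2 * (m:ℝ) + 6) / (m + 1)) * ((m + 1) / (2 * m + 6)))
  have hPc : ContinuousOn P (Icc 0 1) := by
    have : ContinuousOn (fun r => g r ^ ((2 * (m:ℝ) + 6) / (m + 1))) (Icc 0 1) :=
      hgc.rpow_const (fun x _ => Or.inr hq.le)
    fun_prop
  have hP : ∀ r ∈ Ioo (0:ℝ) 1, deriv P r < 0 := by
    intro r hr
    have hr0 : 0 < r := hr.1
    have hgr := hpos r hr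
    have hpw : HasDerivAt (fun r => g r ^ ((2 * (m:ℝ) + 6) / (m + 1)))
        (w r * ((2 * (m:ℝ) + 6) / (m + 1)) * g r ^ (((m:ℝ) + 5) / (m + 1))) r := by
      have := (hg r hr).rpow_const (p := (2 * (m:ℝ) + 6) / (m + 1)) (Or.inl hgr.ne')
      have e : (2 * (m:ℝ) + 6) / (m + 1) - 1 = ((m:ℝ) + 5) / (m + 1) := by
        field_simp; ring
      rwa [e] at this
    have hpe : g r ^ ((2 * (m:ℝ) + 6) / (m + 1)) = g r ^ (((m:ℝ) + 5) / (m + 1)) * g r := by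
      rw [← Real.rpow_add_one hgr.ne']
      congr 1; field_simp; ring
    have hy : 0 < g r ^ (((m:ℝ) + 5) / (m + 1)) := Real.rpow_pos_of_pos hgr _
    have ho := hode r hr
    have d1 := ((hasDerivAt_pow (m + 2) r).const_mul (((m:ℝ) + 1) / 2)).fun_mul
      ((hg r hr).fun_mul (hw r hr))
    have d2 := (hasDerivAt_pow (m + 3) r).fun_mul ((hasDerivAt_pow (m + 1) r).const_sub 1)
    have d3 := (((hw r hr).fun_pow 2).div_const 2).fun_add
      (((((hasDerivAt_pow (m + 1) r).const_mul lam).const_add 1).fun_mul hpw).mul_const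
        (((m:ℝ) + 1) / (2 * m + 6)))
    have d := d1.fun_add (d2.fun_mul d3)
    have hd : HasDerivAt P _ r := d
    rw [hd.deriv, hpe]
    generalize g r ^ (((m:ℝ) + 5) / (m + 1)) = y at *
    have hw2 : w2 r = -((m:ℝ) + 2) / r * w r - (1 + lam * r ^ (m + 1)) * y := by
      linear_combination -ho
    rw [hw2]
    have ho := hr.2
    generalize w r = v at *
    generalize g r = z at *
    have e1 : m + 2 - 1 = m + 1 := rfl
    have e2 : m + 3 - 1 = m + 2 := rfl
    have e3 : m + 1 - 1 = m := rfl
    rw [e1, e2, e3]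
    have hs : 0 < r ^ m := by positivity
    simp only [pow_succ r m, pow_succ r (m+1), pow_succ r (m+2)]
    generalize r ^ m = s at *
    have hneg : 0 < ((m:ℝ) + 1) * (s * r) * (s * r * r) * y * z *
        ((2 * (m + 2) - lam * (m + 1)) + lam * (s * r) * (3 * m + 5)) / (2 * m + 6) := by
      have hb : 0 < (2 * ((m:ℝ) + 2) - lam * (m + 1)) + lam * (s * r) * (3 * m + 5) := by
        rcases h0.eq_or_lt with h | h
        · rw [← h]; simp; positivity
        · have : 0 < lam * (s * r) * (3 * (m:ℝ) + 5) := by positivity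
          linarith
      positivity
    refine lt_of_eq_of_lt ?_ (neg_lt_zero.mpr hneg)
    push_cast
    field_simp
    ring
  have := strictAntiOn_of_deriv_neg (convex_Icc 0 1) hPc (by rwa [interior_Icc])
    (left_mem_Icc.2 zero_le_one) (right_mem_Icc.2 zero_le_one) zero_lt_one
  simp [P, hg1] at this

theorem stmt_9 (N : ℕ) (hN : 3 ≤ N) (lam : ℝ)
    (hlam : lam ∈ Icc 0 (2 * ((N : ℝ) - 1) / ((N : ℝ) - 2))) :
    ¬ ∃ u : EuclideanSpace ℝ (Fin N) → ℝ,
      (∀ x y : EuclideanSpace ℝ (Fin N), ‖x‖ = ‖y‖ → u x = u y) ∧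
      ContDiffOn ℝ 1 u (closedBall 0 1) ∧
      ContDiffOn ℝ 2 u (ball 0 1) ∧
      (∀ x ∈ ball (0 : EuclideanSpace ℝ (Fin N)) 1, 0 < u x) ∧
      (∀ x ∈ sphere (0 : EuclideanSpace ℝ (Fin N)) 1, u x = 0) ∧
      (∀ x ∈ ball (0 : EuclideanSpace ℝ (Fin N)) 1,
        -laplacian u x
          = (1 + lam * ‖x‖ ^ ((N : ℝ) - 2)) * u x ^ (((N : ℝ) + 2) / ((N : ℝ) - 2))) := by
  rintro ⟨u, hrad, hC1, hC2, hpos, hzero, heq⟩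
  obtain ⟨m, rfl⟩ : ∃ m, N = m + 3 := ⟨N - 3, by omega⟩
  have c2 : ((m + 3 : ℕ) : ℝ) - 2 = ((m + 1 : ℕ) : ℝ) := by push_cast; ring
  have hn : (0:ℝ) < m + 1 := by positivity
  let e : EuclideanSpace ℝ (Fin (m + 3)) := EuclideanSpace.single 0 1
  have he : ‖e‖ = 1 := by simp [e]
  have hte : ∀ t : ℝ, ‖t • e‖ = |t| := fun t => by rw [norm_smul, he]; simp
  let g : ℝ → ℝ := fun t => u (t • e)
  have hlin : ∀ n, ContDiff ℝ n (fun t : ℝ => t • e) := fun n => contDiff_id.smul contDiff_const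
  have hg1 : ContDiffOn ℝ 1 g (Icc (-1) 1) := by
    refine hC1.comp (hlin 1).contDiffOn ?_
    intro t ht
    rw [mem_closedBall_zero_iff, hte]; exact abs_le.2 ht
  have hg2 : ContDiffOn ℝ 2 g (Ioo (-1) 1) := by
    refine hC2.comp (hlin 2).contDiffOn ?_
    intro t ht
    rw [mem_ball_zero_iff, hte]; exact abs_lt.2 ht
  let w := derivWithin g (Icc (-1) 1)
  have hwc : ContinuousOn w (Icc (-1) 1) :=
    hg1.continuousOn_derivWithin (uniqueDiffOn_Icc (by norm_num)) le_rfl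
  have hwd : ∀ t ∈ Ioo (-1:ℝ) 1, w t = deriv g t := fun t ht =>
    derivWithin_of_mem_nhds (Icc_mem_nhds ht.1 ht.2)
  have hgd : ∀ t ∈ Ioo (-1:ℝ) 1, HasDerivAt g (w t) t := by
    intro t ht
    rw [hwd t ht]
    exact ((hg2.contDiffAt (isOpen_Ioo.mem_nhds ht)).differentiableAt (by norm_num)).hasDerivAt
  have hwd2 : ∀ t ∈ Ioo (-1:ℝ) 1, HasDerivAt w (deriv (deriv g) t) t := by
    intro t ht
    have h1 : ContDiffOn ℝ 1 (deriv g) (Ioo (-1) 1) :=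
      ((contDiffOn_succ_iff_deriv_of_isOpen (n := 1) isOpen_Ioo).1 hg2).2.2
    have h2 := ((h1.contDiffAt (isOpen_Ioo.mem_nhds ht)).differentiableAt (by norm_num)).hasDerivAt
    refine h2.congr_of_eventuallyEq ?_
    filter_upwards [isOpen_Ioo.mem_nhds ht] with s hs using hwd s hs
  have hsub : Icc (0:ℝ) 1 ⊆ Icc (-1) 1 := Icc_subset_Icc_left (by norm_num)
  have hsub' : Ioo (0:ℝ) 1 ⊆ Ioo (-1) 1 := Ioo_subset_Ioo_left (by norm_num)
  refine ode_nonexist m lam hlam.1 ?_ g w (deriv (deriv g)) (hg1.continuousOn.mono hsub)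
    (hwc.mono hsub) (fun t ht => hgd t (hsub' ht)) (fun t ht => hwd2 t (hsub' ht)) ?_ ?_ ?_
  · have := hlam.2
    rw [c2] at this
    push_cast at this
    rw [le_div_iff₀ hn] at this
    linarith
  · intro t ht
    apply hpos
    rw [mem_ball_zero_iff, hte, abs_of_pos ht.1]; exact ht.2
  · apply hzero
    simp [he]
  · intro t ht
    have hnt : ‖t • e‖ = t := by rw [hte, abs_of_pos ht.1]
    have h := heq (t • e) (by rw [mem_ball_zero_iff, hnt]; exact ht.2)
    rw [radial_laplacian u g w (fun y => hrad _ _ (by rw [hte, abs_norm]))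
      (fun t ht => hgd t (hsub' ht)) _ t ht (hwd2 t (hsub' ht)) _ hnt, hnt, c2,
      Real.rpow_natCast] at h
    have e1 : ((m + 3 : ℕ) : ℝ) - 1 = m + 2 := by push_cast; ring
    have e2 : ((m + 3 : ℕ) : ℝ) + 2 = m + 5 := by push_cast; ring
    have e3 : ((m + 1 : ℕ) : ℝ) = m + 1 := by push_cast; ring
    rw [e1, e2, e3] at h
    exact h
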